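/- arXiv:1601.03438 — 7 statements merged into one kernel-verified Lean document; each statement's English description precedes it below -/
import Mathlib

section
/- Let M be an R-module projective in σ[M] and N a fully invariant submodule of M. Then N is semiprime in M (i.e., for every fully invariant submodule K with K_M K ⊆ N one has K ⊆ N) if and only if for every submodule K of M with N ⊆ K and K_M K ⊆ N, one has K = N. -/
/- Common definitions: the category σ[M], projectivity in σ[M], the product
   K_M L of submodules, annihilators, prime/semiprime submodules, hereditary
   torsion theories, M-singular modules, etc., following the paper. -/

universe u v

section Defs

variable (R : Type u) [Ring R]

/-- `N` belongs to `σ[M]`: `N` is isomorphic to a submodule of an `M`-generated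
module, i.e. `N` embeds into a quotient of a direct sum of copies of `M`. -/
def InSigma (M : Type v) [AddCommGroup M] [Module R M]
    (N : Type v) [AddCommGroup N] [Module R N] : Prop :=
  ∃ (ι : Type v) (K : Submodule R (ι →₀ M)) (g : N →ₗ[R] ((ι →₀ M) ⧸ K)),
    Function.Injective g

/-- `M` is projective in `σ[M]`. -/
def ProjInSigma (M : Type v) [AddCommGroup M] [Module R M] : Prop :=
  ∀ (A B : Type v) [AddCommGroup A] [Module R A] [AddCommGroup B] [Module R B],
    InSigma R M A → InSigma R M B →
      ∀ (p : A →ₗ[R] B), Function.Surjective p →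
        ∀ f : M →ₗ[R] B, ∃ g : M →ₗ[R] A, p.comp g = f

variable (M : Type v) [AddCommGroup M] [Module R M]

/-- The product `K_M L = Σ { f(K) : f ∈ Hom_R(M, L) }` of submodules of `M`. -/
def prodM (K L : Submodule R M) : Submodule R M :=
  ⨆ f ∈ {f : M →ₗ[R] M | LinearMap.range f ≤ L}, Submodule.map f K

/-- `Ann_M(X) = ∩ { ker f : f ∈ Hom_R(M, X) }`. -/
def annM (X : Type v) [AddCommGroup X] [Module R X] : Submodule R M :=
  ⨅ f : M →ₗ[R] X, LinearMap.ker f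

/-- The right annihilator `Ann_M^r(N) = Σ { L ⊆ M : N_M L = 0 }`. -/
def annMr (N : Submodule R M) : Submodule R M :=
  sSup {L : Submodule R M | prodM R M N L = ⊥}

/-- A submodule is fully invariant if it is stable under all endomorphisms. -/
def IsFullyInvariant (N : Submodule R M) : Prop :=
  ∀ f : M →ₗ[R] M, Submodule.map f N ≤ N

/-- `M` is a semiprime module: `K_M K = 0` implies `K = 0`. -/
def IsSemiprime : Prop :=
  ∀ K : Submodule R M, prodM R M K K = ⊥ → K = ⊥

/-- `P` is prime in `M`. -/
def PrimeIn (P : Submodule R M) : Prop :=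
  P ≠ ⊤ ∧ IsFullyInvariant R M P ∧
    ∀ K L : Submodule R M, IsFullyInvariant R M K → IsFullyInvariant R M L →
      prodM R M K L ≤ P → K ≤ P ∨ L ≤ P

/-- `P` is a minimal prime in `M`. -/
def MinPrimeIn (P : Submodule R M) : Prop :=
  PrimeIn R M P ∧ ∀ Q : Submodule R M, PrimeIn R M Q → Q ≤ P → Q = P

/-- Powers of a submodule: `powM N k = N^(k+1)`, i.e. `powM N 0 = N` and
`powM N (k+1) = N_M (powM N k)`. -/
def powM (N : Submodule R M) : ℕ → Submodule R M
  | 0 => N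
  | k + 1 => prodM R M N (powM N k)

/-- The set of annihilator submodules `∩_{f ∈ X} ker f` for `X ⊆ End_R(M)`. -/
def AnnSet : Set (Submodule R M) :=
  {N | ∃ X : Set (M →ₗ[R] M), N = ⨅ f ∈ X, LinearMap.ker f}

/-- `M` satisfies ACC on annihilators. -/
def AccOnAnnihilators : Prop :=
  ∀ c : ℕ → Submodule R M, (∀ n, c n ∈ AnnSet R M) → Monotone c →
    ∃ n, ∀ m, n ≤ m → c m = c n

/-- `U` is a uniform submodule of `M`. -/
def UniformSub (U : Submodule R M) : Prop :=
  U ≠ ⊥ ∧ ∀ A B : Submodule R M, A ≤ U → B ≤ U → A ≠ ⊥ → B ≠ ⊥ → A ⊓ B ≠ ⊥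

end Defs

section Torsion

variable (R : Type u) [Ring R]

/-- A hereditary torsion theory, presented via its torsion class: a class of
modules closed under submodules, quotients, extensions, isomorphisms and
direct sums. -/
structure HTC : Type (max u (v + 1)) where
  torsion : ∀ (N : Type v) [AddCommGroup N] [Module R N], Prop
  closed_sub : ∀ (N : Type v) [AddCommGroup N] [Module R N],
    torsion N → ∀ K : Submodule R N, torsion K
  closed_quot : ∀ (N : Type v) [AddCommGroup N] [Module R N],
    torsion N → ∀ K : Submodule R N, torsion (N ⧸ K)
  closed_ext : ∀ (N : Type v) [AddCommGroup N] [Module R N] (K : Submodule R N),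
    torsion K → torsion (N ⧸ K) → torsion N
  closed_iso : ∀ (N N' : Type v) [AddCommGroup N] [Module R N]
    [AddCommGroup N'] [Module R N'], (N ≃ₗ[R] N') → torsion N → torsion N'
  closed_dsum : ∀ (ι : Type v) (F : ι → Type v) [DecidableEq ι]
    [∀ i, AddCommGroup (F i)] [∀ i, Module R (F i)],
    (∀ i, torsion (F i)) → torsion (DirectSum ι F)

/-- `N` is `τ`-torsion-free. -/
def TorsionFreeFor (τ : HTC.{u, v} R) (N : Type v) [AddCommGroup N] [Module R N] : Prop :=
  ∀ K : Submodule R N, τ.torsion ↥K → K = ⊥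

variable (M : Type v) [AddCommGroup M] [Module R M]

/-- `N` is `χ(M)`-torsion: torsion for some (hence for the greatest) hereditary
torsion theory for which `M` is torsion-free. -/
def ChiTorsion (N : Type v) [AddCommGroup N] [Module R N] : Prop :=
  ∃ τ : HTC.{u, v} R, TorsionFreeFor R τ M ∧ τ.torsion N

/-- `N` is `χ(M)`-torsion-free. -/
def ChiTorsionFree (N : Type v) [AddCommGroup N] [Module R N] : Prop :=
  ∀ K : Submodule R N, ChiTorsion R M ↥K → K = ⊥

/-- `X` is `M`-singular: `X ≅ L/K` with `L ∈ σ[M]` and `K` essential in `L`. -/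
def IsMSingular (X : Type v) [AddCommGroup X] [Module R X] : Prop :=
  ∃ (L : Type v) (iL : AddCommGroup L)
    (mL : @Module R L inferInstance iL.toAddCommMonoid),
    letI := iL
    letI := mL
    InSigma R M L ∧ ∃ K : Submodule R L,
      (∀ K' : Submodule R L, K' ≠ ⊥ → K ⊓ K' ≠ ⊥) ∧ Nonempty (X ≃ₗ[R] (L ⧸ K))

/-- The `M`-singular submodule `Z(M)` of `M`. -/
def singularSub : Submodule R M :=
  sSup {K : Submodule R M | IsMSingular R M ↥K}

/-- `Ass_M(X)`: the set of primes in `M` associated to `X`. -/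
def AssM (X : Type v) [AddCommGroup X] [Module R X] : Set (Submodule R M) :=
  {P | P ≠ ⊤ ∧ IsFullyInvariant R M P ∧
    ∃ L : Submodule R X, L ≠ ⊥ ∧
      ∀ L' : Submodule R X, L' ≠ ⊥ → L' ≤ L → annM R M ↥L' = P}

/-- `E` is an injective object of `σ[M]`. -/
def InjInSigma (E : Type v) [AddCommGroup E] [Module R E] : Prop :=
  InSigma R M E ∧
    ∀ (B : Type v) [AddCommGroup B] [Module R B], InSigma R M B →
      ∀ (A : Submodule R B) (f : ↥A →ₗ[R] E),
        ∃ g : B →ₗ[R] E, ∀ a : A, g ↑a = f a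

/-- `E` is an indecomposable module. -/
def Indecomp (E : Type v) [AddCommGroup E] [Module R E] : Prop :=
  (⊥ : Submodule R E) ≠ ⊤ ∧
    ∀ A B : Submodule R E, IsCompl A B → A = ⊥ ∨ A = ⊤

/-- `M` has finite uniform dimension: there is no infinite independent family
of nonzero submodules. -/
def FiniteUniformDimension : Prop :=
  ¬ ∃ f : ℕ → Submodule R M, (∀ n, f n ≠ ⊥) ∧
      ∀ n : ℕ, f n ⊓ (⨆ m ∈ {m : ℕ | m ≠ n}, f m) = ⊥

/-- `M` is a continuous module (conditions C1 and C2). -/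
def ContinuousModule : Prop :=
  (∀ N : Submodule R M, ∃ D : Submodule R M, (∃ D', IsCompl D D') ∧ N ≤ D ∧
      ∀ L : Submodule R M, L ≤ D → L ≠ ⊥ → N ⊓ L ≠ ⊥) ∧
  (∀ N D : Submodule R M, (∃ D', IsCompl D D') → Nonempty (↥N ≃ₗ[R] ↥D) →
      ∃ N', IsCompl N N')

end Torsion

theorem inSigma_of_injective {R : Type u} [Ring R] {M : Type v} [AddCommGroup M] [Module R M]
    {A : Type v} [AddCommGroup A] [Module R A] {ι : Type v} (g : A →ₗ[R] (ι →₀ M))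
    (hg : Function.Injective g) : InSigma R M A := by
  refine ⟨ι, ⊥, (⊥ : Submodule R (ι →₀ M)).mkQ.comp g, ?_⟩
  have hq : Function.Injective (⊥ : Submodule R (ι →₀ M)).mkQ := by
    rw [← LinearMap.ker_eq_bot, Submodule.ker_mkQ]
  exact hq.comp hg

theorem prodM_le_iff {R : Type u} [Ring R] {M : Type v} [AddCommGroup M] [Module R M]
    {K L N : Submodule R M} :
    prodM R M K L ≤ N ↔ ∀ f : M →ₗ[R] M, LinearMap.range f ≤ L → ∀ x ∈ K, f x ∈ N := by
  simp only [prodM, iSup_le_iff, Set.mem_ofPred_eq, Submodule.map_le_iff_le_comap]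
  rfl

/-- If `M` is projective in `σ[M]`, an endomorphism with values in `∑ i, h i (L i)` lifts to
the submodule of `⨁ i, M` of families with components in the `L i`. -/
theorem ProjInSigma.exists_lift {R : Type u} [Ring R] {M : Type v} [AddCommGroup M] [Module R M]
    (hproj : ProjInSigma R M) {ι : Type v} (h : ι → M →ₗ[R] M) (L : ι → Submodule R M)
    (f : M →ₗ[R] M) (hf : LinearMap.range f ≤ ⨆ i, (L i).map (h i)) :
    ∃ g : M →ₗ[R] (ι →₀ M), (∀ x i, g x i ∈ L i) ∧ ∀ x, f x = (g x).sum fun i => h i := by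
  classical
  let A : Submodule R (ι →₀ M) := ⨅ i, (L i).comap (Finsupp.lapply i)
  have memA : ∀ a, a ∈ A ↔ ∀ i, a i ∈ L i := fun a => by simp [A, Submodule.mem_iInf]
  let P : (ι →₀ M) →ₗ[R] M := Finsupp.lsum ℕ h
  have hB : ∀ x, f x ∈ A.map P := fun x => by
    refine (hf.trans (iSup_le fun i => ?_)) (LinearMap.mem_range_self f x)
    rintro _ ⟨y, hy, rfl⟩
    refine ⟨Finsupp.single i y, (memA _).2 fun j => ?_, by simp [P]⟩
    by_cases hij : i = j
    · subst hij; simpa using hy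
    · simp [hij]
  obtain ⟨g, hg⟩ := hproj A (A.map P) (inSigma_of_injective A.subtype A.injective_subtype)
    (inSigma_of_injective ((Finsupp.lsingle PUnit.unit).comp (A.map P).subtype)
      ((Finsupp.single_injective _).comp (A.map P).injective_subtype))
    (P.submoduleMap A) (P.submoduleMap_surjective A) (f.codRestrict _ hB)
  refine ⟨A.subtype.comp g, fun x => (memA _).1 (g x).2, fun x => ?_⟩
  exact (congrArg Subtype.val (LinearMap.congr_fun hg x)).symm

/-- semiprime in `M` iff every submodule `K ⊇ N` with
`K_M K ⊆ N` satisfies `K = N`. -/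
theorem stmt_0 (R : Type u) [Ring R] (M : Type v) [AddCommGroup M] [Module R M]
    (hproj : ProjInSigma R M) (N : Submodule R M) (hFI : IsFullyInvariant R M N) :
    (∀ K : Submodule R M, IsFullyInvariant R M K → prodM R M K K ≤ N → K ≤ N) ↔
      (∀ K : Submodule R M, N ≤ K → prodM R M K K ≤ N → K = N) := by
  have hN : ∀ (f : M →ₗ[R] M), ∀ x ∈ N, f x ∈ N := fun f x hx => hFI f ⟨x, hx, rfl⟩
  constructor
  · intro hs K hNK hK
    rw [prodM_le_iff] at hK
    let K' : Submodule R M := ⨆ h : M →ₗ[R] M, K.map h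
    have hK' : IsFullyInvariant R M K' := fun f => by
      rw [Submodule.map_iSup]
      refine iSup_le fun h => ?_
      rw [← Submodule.map_comp]
      exact le_iSup (fun h : M →ₗ[R] M => K.map h) (f.comp h)
    have hKK' : K ≤ K' := by
      simpa using le_iSup (fun h : M →ₗ[R] M => K.map h) LinearMap.id
    refine le_antisymm (hKK'.trans (hs K' hK' (prodM_le_iff.2 fun f hf => ?_))) hNK
    have key : ∀ f : M →ₗ[R] M, LinearMap.range f ≤ K' → ∀ x ∈ K, f x ∈ N := fun f hf x hx => by
      obtain ⟨g, hgL, hgf⟩ := hproj.exists_lift (fun h => h) (fun _ => K) f hf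
      rw [hgf]
      refine Submodule.sum_mem _ fun h _ => hN h _ ?_
      refine hK ((Finsupp.lapply h).comp g) ?_ x hx
      rintro _ ⟨y, rfl⟩
      exact hgL y h
    change K' ≤ N.comap f
    refine iSup_le fun h => ?_
    rintro _ ⟨x, hx, rfl⟩
    exact key (f.comp h) ((LinearMap.range_comp_le_range h f).trans hf) x hx
  · intro hs K _ hK
    rw [prodM_le_iff] at hK
    refine le_sup_left.trans (hs (K ⊔ N) le_sup_right (prodM_le_iff.2 fun f hf => ?_)).le
    change K ⊔ N ≤ N.comap f
    refine sup_le (fun x hx => ?_) (hN f)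
    obtain ⟨g, hgL, hgf⟩ := hproj.exists_lift (ι := ULift Bool) (fun _ => LinearMap.id)
      (fun i => bif i.down then K else N) f (hf.trans (sup_le
        (by simpa using le_iSup (fun i : ULift.{v} Bool => bif i.down then K else N) ⟨true⟩)
        (by simpa using le_iSup (fun i : ULift.{v} Bool => bif i.down then K else N) ⟨false⟩)))
    change f x ∈ N
    rw [hgf]
    refine Submodule.sum_mem _ fun i _ => ?_
    obtain ⟨_ | _⟩ := i
    · exact hgL x ⟨false⟩
    · refine hK ((Finsupp.lapply ⟨true⟩).comp g) ?_ x hx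
      rintro _ ⟨y, rfl⟩
      exact hgL y ⟨true⟩
end

section
/- Let M be an R-module projective in σ[M] and a semiprime module. Then for every submodule L of M, L ∩ Ann_M(L) = 0. -/
/- Common definitions: the category σ[M], projectivity in σ[M], the product
   K_M L of submodules, annihilators, prime/semiprime submodules, hereditary
   torsion theories, M-singular modules, etc., following the paper. -/

universe u v

/-- in a semiprime module, `L ∩ Ann_M(L) = 0` for every
submodule `L`. -/
theorem stmt_3 (R : Type u) [Ring R] (M : Type v) [AddCommGroup M] [Module R M]
    (hproj : ProjInSigma R M) (hsemi : IsSemiprime R M) (L : Submodule R M) :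
    L ⊓ annM R M ↥L = ⊥ := by
  refine hsemi _ (eq_bot_iff.2 (iSup₂_le fun f hf => ?_))
  rintro _ ⟨x, hx, rfl⟩
  have hfL (y : M) : f y ∈ L := (hf (LinearMap.mem_range_self f y)).1
  have hker : x ∈ LinearMap.ker (f.codRestrict L hfL) := (Submodule.mem_iInf _).1 hx.2 _
  simpa using hker
end

section
/- Let M be an R-module projective in σ[M] and a semiprime module. Then M is retractable, i.e., Hom_R(M, N) ≠ 0 for every nonzero submodule N of M. -/
/- Common definitions: the category σ[M], projectivity in σ[M], the product
   K_M L of submodules, annihilators, prime/semiprime submodules, hereditary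
   torsion theories, M-singular modules, etc., following the paper. -/

universe u v

/-- a semiprime module projective in `σ[M]` is retractable:
`Hom_R(M, N) ≠ 0` for every nonzero submodule `N`. -/
theorem stmt_4 (R : Type u) [Ring R] (M : Type v) [AddCommGroup M] [Module R M]
    (hproj : ProjInSigma R M) (hsemi : IsSemiprime R M)
    (N : Submodule R M) (hN : N ≠ ⊥) :
    ∃ f : M →ₗ[R] ↥N, f ≠ 0 := by
  by_contra! h
  refine hN (hsemi N ?_)
  simp only [prodM, Set.mem_ofPred_eq, iSup_eq_bot]
  intro f hf
  have hf0 : f = 0 := by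
    ext x
    simpa using congrArg (fun g => ((g x : N) : M))
      (h (f.codRestrict N fun x => hf (LinearMap.mem_range_self f x)))
  rw [hf0, Submodule.map_zero]
end

section
/- Let M be an R-module projective in σ[M] and a semiprime module, and let τ be a hereditary torsion theory on σ[M]. If U is a uniform submodule of M which is τ-torsion-free, then Ann_M(U) is a τ-pure and prime in M submodule; moreover Ann_M(U) = Ann_M(U') for every nonzero submodule U' of U. -/
/- Common definitions: the category σ[M], projectivity in σ[M], the product
   K_M L of submodules, annihilators, prime/semiprime submodules, hereditary
   torsion theories, M-singular modules, etc., following the paper. -/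

universe u v

theorem mem_annM {R : Type u} [Ring R] {M : Type v} [AddCommGroup M] [Module R M]
    {X : Type v} [AddCommGroup X] [Module R X] {m : M} :
    m ∈ annM R M X ↔ ∀ f : M →ₗ[R] X, f m = 0 := by
  simp [annM, Submodule.mem_iInf]

theorem inSigma_submodule {R : Type u} [Ring R] {M : Type v} [AddCommGroup M] [Module R M]
    (N : Submodule R M) : InSigma R M N := by
  refine ⟨PUnit.{v + 1}, ⊥, (Submodule.mkQ ⊥).comp
    ((Finsupp.lsingle PUnit.unit).comp N.subtype), ?_⟩
  have hq : Function.Injective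
      (Submodule.mkQ (⊥ : Submodule R (PUnit.{v + 1} →₀ M))) := by
    rw [← LinearMap.ker_eq_bot, Submodule.ker_mkQ]
  exact hq.comp ((Finsupp.single_injective _).comp N.injective_subtype)

theorem HTC.torsion_map {R : Type u} [Ring R] (τ : HTC.{u, v} R)
    {N X : Type v} [AddCommGroup N] [Module R N] [AddCommGroup X] [Module R X]
    (f : N →ₗ[R] X) {K : Submodule R N} (hK : τ.torsion K) : τ.torsion (K.map f) :=
  τ.closed_iso _ _
    ((f.submoduleMap K).quotKerEquivOfSurjective (f.submoduleMap_surjective K))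
    (τ.closed_quot _ hK _)

theorem torsionFreeFor_quotient_annM {R : Type u} [Ring R] {M : Type v} [AddCommGroup M]
    [Module R M] {τ : HTC.{u, v} R} {X : Type v} [AddCommGroup X] [Module R X]
    (hX : TorsionFreeFor R τ X) : TorsionFreeFor R τ (M ⧸ annM R M X) := by
  intro K hK
  rw [Submodule.eq_bot_iff]
  intro x hx
  obtain ⟨m, rfl⟩ := Submodule.mkQ_surjective _ x
  rw [Submodule.mkQ_apply, Submodule.Quotient.mk_eq_zero, mem_annM]
  intro f
  have hf : annM R M X ≤ LinearMap.ker f := fun m hm => mem_annM.1 hm f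
  have h := hX _ (τ.torsion_map ((annM R M X).liftQ f hf) hK)
  simpa using (Submodule.eq_bot_iff _).1 h _ (Submodule.mem_map_of_mem hx)

theorem isFullyInvariant_annM {R : Type u} [Ring R] {M : Type v} [AddCommGroup M]
    [Module R M] (X : Type v) [AddCommGroup X] [Module R X] :
    IsFullyInvariant R M (annM R M X) := by
  rintro f _ ⟨m, hm, rfl⟩
  exact mem_annM.2 fun g => mem_annM.1 hm (g.comp f)

theorem IsSemiprime.exists_apply_ne_zero {R : Type u} [Ring R] {M : Type v} [AddCommGroup M]
    [Module R M] (hsemi : IsSemiprime R M) {V : Submodule R M} (hV : V ≠ ⊥) :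
    ∃ f : M →ₗ[R] V, ∃ v ∈ V, f v ≠ 0 := by
  by_contra! h
  refine hV (hsemi V (eq_bot_iff.2 (iSup₂_le ?_)))
  rintro f hf _ ⟨v, hv, rfl⟩
  have := h (f.codRestrict V fun m => hf ⟨m, rfl⟩) v hv
  simpa using congrArg Subtype.val this

theorem annM_eq_of_le_uniformSub {R : Type u} [Ring R] {M : Type v} [AddCommGroup M]
    [Module R M] (hsemi : IsSemiprime R M) {U U' : Submodule R M} (hU : UniformSub R M U)
    (hU' : U' ≠ ⊥) (hle : U' ≤ U) : annM R M U' = annM R M U := by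
  apply le_antisymm
  · intro n hn
    rw [mem_annM]
    intro f
    by_contra hfn
    let W : Submodule R M := (annM R M U').map (U.subtype.comp f)
    have hWU : W ≤ U := by
      rintro _ ⟨m, -, rfl⟩
      exact (f m).2
    have hW : W ≠ ⊥ := fun h => hfn <| Subtype.ext <|
      (Submodule.eq_bot_iff W).1 h _ (Submodule.mem_map_of_mem hn)
    obtain ⟨g, v, ⟨⟨m, hm, rfl⟩, -⟩, hgv⟩ :=
      hsemi.exists_apply_ne_zero (hU.2 W U' hWU hle hW hU')
    apply hgv
    have := mem_annM.1 hm
      ((Submodule.inclusion (inf_le_right : W ⊓ U' ≤ U')).comp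
        (g.comp (U.subtype.comp f)))
    have hval := congrArg Subtype.val this
    exact Subtype.ext hval
  · intro n hn
    refine mem_annM.2 fun f => ?_
    have := mem_annM.1 hn ((Submodule.inclusion hle).comp f)
    have hval := congrArg Subtype.val this
    exact Subtype.ext hval

theorem annM_ne_top {R : Type u} [Ring R] {M : Type v} [AddCommGroup M] [Module R M]
    (hsemi : IsSemiprime R M) {U : Submodule R M} (hU : U ≠ ⊥) : annM R M U ≠ ⊤ := by
  intro h
  obtain ⟨f, v, -, hv⟩ := hsemi.exists_apply_ne_zero hU
  exact hv (mem_annM.1 (h ▸ Submodule.mem_top : v ∈ annM R M U) f)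

theorem le_annM_map_of_prodM_le {R : Type u} [Ring R] {M : Type v} [AddCommGroup M]
    [Module R M] (hproj : ProjInSigma R M) {U K L : Submodule R M}
    (h : prodM R M K L ≤ annM R M U) (f : M →ₗ[R] U) :
    K ≤ annM R M (L.map (U.subtype.comp f)) := by
  intro k hk
  refine mem_annM.2 fun g => ?_
  obtain ⟨l, rfl⟩ := hproj _ _ (inSigma_submodule L) (inSigma_submodule _)
    ((U.subtype.comp f).submoduleMap L) (LinearMap.submoduleMap_surjective _ L) g
  have hl : LinearMap.range (L.subtype.comp l) ≤ L := by
    rintro _ ⟨m, rfl⟩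
    exact (l m).2
  have hmem : L.subtype.comp l k ∈ prodM R M K L :=
    le_iSup₂_of_le (f := fun (f : M →ₗ[R] M) (_ : f ∈ {f | LinearMap.range f ≤ L}) =>
      Submodule.map f K) _ hl le_rfl (Submodule.mem_map_of_mem hk)
  have hval := congrArg Subtype.val (mem_annM.1 (h hmem) f)
  exact Subtype.ext hval

theorem primeIn_annM_of_uniformSub {R : Type u} [Ring R] {M : Type v} [AddCommGroup M]
    [Module R M] (hproj : ProjInSigma R M) (hsemi : IsSemiprime R M) {U : Submodule R M}
    (hU : UniformSub R M U) : PrimeIn R M (annM R M U) := by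
  refine ⟨annM_ne_top hsemi hU.1, isFullyInvariant_annM U, fun K L _ _ h => ?_⟩
  rw [or_iff_not_imp_right]
  intro hL
  obtain ⟨l, hl, hlU⟩ := SetLike.not_le_iff_exists.1 hL
  rw [mem_annM] at hlU
  push Not at hlU
  obtain ⟨f, hf⟩ := hlU
  rw [← annM_eq_of_le_uniformSub hsemi hU (U' := L.map (U.subtype.comp f))]
  · exact le_annM_map_of_prodM_le hproj h f
  · exact fun hbot => hf <| Subtype.ext <|
      (Submodule.eq_bot_iff _).1 hbot _ (Submodule.mem_map_of_mem hl)
  · rintro _ ⟨m, -, rfl⟩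
    exact (f m).2

/-- for a uniform `τ`-torsion-free submodule `U` of a semiprime
module `M`, `Ann_M(U)` is `τ`-pure and prime in `M`, and `Ann_M(U) = Ann_M(U')`
for every nonzero `U' ⊆ U`. -/
theorem stmt_6 (R : Type u) [Ring R] (M : Type v) [AddCommGroup M] [Module R M]
    (hproj : ProjInSigma R M) (hsemi : IsSemiprime R M)
    (τ : HTC.{u, v} R) (U : Submodule R M) (hU : UniformSub R M U)
    (hUtf : TorsionFreeFor R τ ↥U) :
    TorsionFreeFor R τ (M ⧸ annM R M ↥U) ∧ PrimeIn R M (annM R M ↥U) ∧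
      ∀ U' : Submodule R M, U' ≠ ⊥ → U' ≤ U → annM R M ↥U' = annM R M ↥U := by
  exact ⟨torsionFreeFor_quotient_annM hUtf, primeIn_annM_of_uniformSub hproj hsemi hU,
    fun _ hne hle => annM_eq_of_le_uniformSub hsemi hU hne hle⟩
end

section
/- Let M be an R-module projective in σ[M] and a semiprime module. If N is a submodule of M such that P = Ann_M(N) is prime in M, then P is a minimal prime in M. -/
/- Common definitions: the category σ[M], projectivity in σ[M], the product
   K_M L of submodules, annihilators, prime/semiprime submodules, hereditary
   torsion theories, M-singular modules, etc., following the paper. -/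

universe u v

section FullyInvariantHull

variable {R : Type u} [Ring R] {M : Type v} [AddCommGroup M] [Module R M]

theorem InSigma.of_injective {A ι : Type v} [AddCommGroup A] [Module R A]
    (g : A →ₗ[R] (ι →₀ M)) (hg : Function.Injective g) : InSigma R M A := by
  refine ⟨ι, ⊥, (Submodule.mkQ ⊥).comp g, ?_⟩
  have hq : Function.Injective (Submodule.mkQ (⊥ : Submodule R (ι →₀ M))) :=
    LinearMap.ker_eq_bot.mp (Submodule.ker_mkQ _)
  exact hq.comp hg

theorem prodM_eq_bot_iff {K L : Submodule R M} :
    prodM R M K L = ⊥ ↔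
      ∀ f : M →ₗ[R] M, LinearMap.range f ≤ L → ∀ x ∈ K, f x = 0 := by
  simp [prodM, iSup_eq_bot, Submodule.eq_bot_iff]

theorem mem_annM_iff {X : Type v} [AddCommGroup X] [Module R X] {x : M} :
    x ∈ annM R M X ↔ ∀ f : M →ₗ[R] X, f x = 0 := by
  simp [annM]

theorem annM_prodM_self (N : Submodule R M) : prodM R M (annM R M N) N = ⊥ := by
  rw [prodM_eq_bot_iff]
  intro f hf x hx
  have h := mem_annM_iff.mp hx (f.codRestrict N fun y => hf ⟨y, rfl⟩)
  simpa using congrArg Subtype.val h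

/-- The map from the direct sum of copies of `N` indexed by the endomorphisms of `M` that
applies to each copy the corresponding endomorphism. -/
noncomputable def sumEndMap (N : Submodule R M) : ((M →ₗ[R] M) →₀ N) →ₗ[R] M :=
  Finsupp.lsum ℕ fun g : M →ₗ[R] M => g.comp N.subtype

/-- The smallest fully invariant submodule containing `N`. -/
noncomputable def fullyInvariantHull (N : Submodule R M) : Submodule R M :=
  LinearMap.range (sumEndMap N)

theorem le_fullyInvariantHull (N : Submodule R M) : N ≤ fullyInvariantHull N := fun x hx =>
  ⟨Finsupp.single LinearMap.id ⟨x, hx⟩, by simp [sumEndMap]⟩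

theorem isFullyInvariant_fullyInvariantHull (N : Submodule R M) :
    IsFullyInvariant R M (fullyInvariantHull N) := by
  rintro e _ ⟨_, ⟨s, rfl⟩, rfl⟩
  induction s using Finsupp.induction_linear with
  | zero => simp
  | add s t hs ht => simpa only [map_add] using add_mem hs ht
  | single g n => exact ⟨Finsupp.single (e.comp g) n, by simp [sumEndMap]⟩

theorem annM_prodM_fullyInvariantHull (hproj : ProjInSigma R M) (N : Submodule R M) :
    prodM R M (annM R M N) (fullyInvariantHull N) = ⊥ := by
  rw [prodM_eq_bot_iff]
  intro f hf x hx
  have hA : InSigma R M ((M →ₗ[R] M) →₀ N) :=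
    .of_injective (Finsupp.mapRange.linearMap N.subtype)
      (Finsupp.mapRange_injective _ (map_zero _) N.injective_subtype)
  have hB : InSigma R M (fullyInvariantHull N) :=
    .of_injective ((Finsupp.lsingle PUnit.unit).comp (fullyInvariantHull N).subtype)
      ((Finsupp.single_injective _).comp (fullyInvariantHull N).injective_subtype)
  obtain ⟨h, hh⟩ := hproj _ _ hA hB (sumEndMap N).rangeRestrict
    (sumEndMap N).surjective_rangeRestrict
    (f.codRestrict (fullyInvariantHull N) fun y => hf ⟨y, rfl⟩)
  have hx0 : h x = 0 := by
    ext1 g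
    exact mem_annM_iff.mp hx ((Finsupp.lapply g).comp h)
  have hfx : sumEndMap N (h x) = f x := congrArg Subtype.val (LinearMap.congr_fun hh x)
  rw [← hfx, hx0, map_zero]

theorem annM_eq_top_of_le_annM (hsemi : IsSemiprime R M) {N : Submodule R M}
    (h : N ≤ annM R M N) : annM R M N = ⊤ := by
  have hN : N = ⊥ := hsemi N <| prodM_eq_bot_iff.mpr fun f hf x hx =>
    prodM_eq_bot_iff.mp (annM_prodM_self N) f hf x (h hx)
  subst hN
  exact eq_top_iff.mpr fun x _ => mem_annM_iff.mpr fun f => Subsingleton.elim _ _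

end FullyInvariantHull

/-- if `P = Ann_M(N)` is prime in `M` for a semiprime module `M`,
then `P` is a minimal prime in `M`. -/
theorem stmt_7 (R : Type u) [Ring R] (M : Type v) [AddCommGroup M] [Module R M]
    (hproj : ProjInSigma R M) (hsemi : IsSemiprime R M)
    (N : Submodule R M) (hP : PrimeIn R M (annM R M ↥N)) :
    MinPrimeIn R M (annM R M ↥N) := by
  refine ⟨hP, fun Q hQ hQP => le_antisymm hQP ?_⟩
  refine (hQ.2.2 _ _ hP.2.1 (isFullyInvariant_fullyInvariantHull N) ?_).resolve_right fun h => ?_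
  · rw [annM_prodM_fullyInvariantHull hproj N]
    exact bot_le
  · exact hP.1 (annM_eq_top_of_le_annM hsemi ((le_fullyInvariantHull N).trans (h.trans hQP)))
end

section
/- Let M be an R-module and C ∈ σ[M] a χ(M)-cocritical module. Then there exist submodules C' ⊆ C and M' ⊆ M such that C' is isomorphic to M'. -/
/- Common definitions: the category σ[M], projectivity in σ[M], the product
   K_M L of submodules, annihilators, prime/semiprime submodules, hereditary
   torsion theories, M-singular modules, etc., following the paper. -/

universe u v

section ChiTheory

variable (R : Type u) [Ring R] (M : Type v) [AddCommGroup M] [Module R M]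

/-- No cyclic submodule of `N` has a nonzero homomorphism to `M`: an element of `M` that is
annihilated by the annihilator of some `n : N` vanishes. -/
def NoPartialHom (N : Type v) [AddCommGroup N] [Module R N] : Prop :=
  ∀ (n : N) (m : M), (∀ r : R, r • n = 0 → r • m = 0) → m = 0

/-- The torsion theory `χ(M)`, whose torsion modules are those with no nonzero homomorphism
from a submodule to `M`. -/
def chi : HTC.{u, v} R where
  torsion N _ _ := NoPartialHom R M N
  closed_sub N _ _ h K := fun n m hm =>
    h n m fun r hr => hm r (Subtype.ext (by simpa using hr))
  closed_quot N _ _ h K := by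
    intro n m hm
    obtain ⟨n, rfl⟩ := K.mkQ_surjective n
    refine h n m fun r hr => hm r ?_
    rw [← map_smul, hr, map_zero]
  closed_ext N _ _ K hK hQ := by
    intro n m hm
    refine hQ (K.mkQ n) m fun r hr => ?_
    rw [← map_smul, Submodule.mkQ_apply, Submodule.Quotient.mk_eq_zero] at hr
    refine hK ⟨r • n, hr⟩ (r • m) fun s hs => ?_
    have hs' : s • r • n = 0 := congrArg Subtype.val hs
    rw [smul_smul] at hs' ⊢
    exact hm _ hs'
  closed_iso N N' _ _ _ _ e h := by
    intro n m hm
    refine h (e.symm n) m fun r hr => hm r ?_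
    rwa [← map_smul, LinearEquiv.map_eq_zero_iff] at hr
  closed_dsum ι F _ _ _ h := by
    suffices H : ∀ (x : DirectSum ι F) (t : R) (m : M),
        (∀ r : R, r • t • x = 0 → r • m = 0) → m = 0 by
      intro n m hm
      exact H n 1 m (by simpa using hm)
    intro x
    induction x using DirectSum.induction_on with
    | zero =>
      intro t m hm
      simpa using hm 1 (by simp)
    | of i x =>
      intro t m hm
      refine h i (t • x) m fun r hr => hm r ?_
      change r • t • DirectSum.lof R ι F i x = 0
      rw [← map_smul, ← map_smul, hr, map_zero]
    | add x y hx hy =>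
      intro t m hm
      refine hx t m fun r hr => hy (r * t) (r • m) fun s hs => ?_
      rw [smul_smul]
      apply hm
      rw [smul_add, smul_add, mul_smul, hr, smul_zero, zero_add, mul_smul, ← mul_smul r, hs]

theorem torsionFreeFor_chi : TorsionFreeFor R (chi R M) M := by
  intro K hK
  rw [Submodule.eq_bot_iff]
  intro k hk
  exact hK ⟨k, hk⟩ k fun r hr => congrArg Subtype.val hr

variable {R M}

/-- Elements with the same annihilator span isomorphic cyclic submodules. -/
theorem nonempty_range_toSpanSingleton_equiv {N : Type*} [AddCommGroup N] [Module R N]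
    {n : N} {m : M} (h : ∀ r : R, r • n = 0 ↔ r • m = 0) :
    Nonempty (LinearMap.range (LinearMap.toSpanSingleton R N n) ≃ₗ[R]
      LinearMap.range (LinearMap.toSpanSingleton R M m)) := by
  have hker : LinearMap.ker (LinearMap.toSpanSingleton R N n) =
      LinearMap.ker (LinearMap.toSpanSingleton R M m) := by
    ext r
    simpa using h r
  exact ⟨(LinearMap.quotKerEquivRange _).symm ≪≫ₗ Submodule.quotEquivOfEq _ _ hker ≪≫ₗ
    LinearMap.quotKerEquivRange _⟩

/-- If `n ∈ N` has the same annihilator as `m ∈ M` and `N` is `χ(M)`-torsion, then `m = 0`. -/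
theorem ChiTorsion.eq_zero {N : Type v} [AddCommGroup N] [Module R N] (hN : ChiTorsion R M N)
    {n : N} {m : M} (h : ∀ r : R, r • n = 0 ↔ r • m = 0) : m = 0 := by
  obtain ⟨τ, hτ, hN⟩ := hN
  obtain ⟨e⟩ := nonempty_range_toSpanSingleton_equiv h
  have hbot := hτ _ (τ.closed_iso _ _ e (τ.closed_sub _ hN _))
  rw [Submodule.eq_bot_iff] at hbot
  exact hbot m ⟨1, by simp⟩

/-- A nonzero `χ(M)`-cocritical module has a nonzero submodule isomorphic to a submodule
of `M`. -/
theorem exists_ne_bot_equiv_of_cocritical {C : Type v} [AddCommGroup C] [Module R C]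
    [Nontrivial C] (htf : ChiTorsionFree R M C)
    (hcocrit : ∀ C' : Submodule R C, C' ≠ ⊥ → ChiTorsion R M (C ⧸ C')) :
    ∃ (C' : Submodule R C) (M' : Submodule R M), C' ≠ ⊥ ∧ Nonempty (C' ≃ₗ[R] M') := by
  have hC : ¬ NoPartialHom R M C := fun h =>
    top_ne_bot (htf ⊤ ⟨chi R M, torsionFreeFor_chi R M, (chi R M).closed_sub _ h ⊤⟩)
  simp only [NoPartialHom, not_forall] at hC
  obtain ⟨n, m, hnm, hm⟩ := hC
  let L : Submodule R C := (LinearMap.ker (LinearMap.toSpanSingleton R M m)).map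
    (LinearMap.toSpanSingleton R C n)
  have hL : L = ⊥ := by
    by_contra hL
    refine hm ((hcocrit L hL).eq_zero (n := L.mkQ n) fun r => ?_)
    rw [← map_smul, Submodule.mkQ_apply, Submodule.Quotient.mk_eq_zero]
    refine ⟨?_, fun hr => ⟨r, by simpa using hr, by simp⟩⟩
    rintro ⟨s, hs, hsr⟩
    have hsm : s • m = 0 := by simpa using hs
    have hdiff : (r - s) • n = 0 := by
      rw [sub_smul, sub_eq_zero]
      simpa using hsr.symm
    simpa [sub_smul, hsm] using hnm _ hdiff
  rw [Submodule.eq_bot_iff] at hL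
  refine ⟨_, _, fun hbot => hm ?_, nonempty_range_toSpanSingleton_equiv (n := n) (m := m)
    fun r => ⟨hnm r, fun hr => hL _ ⟨r, by simpa using hr, by simp⟩⟩⟩
  rw [Submodule.eq_bot_iff] at hbot
  have hn : n = 0 := hbot n ⟨1, by simp⟩
  simpa using hnm 1 (by simp [hn])

end ChiTheory

/-- Lemma 2.4: a `χ(M)`-cocritical module `C ∈ σ[M]` has a
submodule isomorphic to a submodule of `M`. -/
theorem stmt_11 (R : Type u) [Ring R] (M : Type v) [AddCommGroup M] [Module R M]
    (C : Type v) [AddCommGroup C] [Module R C] (hC : InSigma R M C)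
    (htf : ChiTorsionFree R M C)
    (hcocrit : ∀ C' : Submodule R C, C' ≠ ⊥ → ChiTorsion R M (C ⧸ C')) :
    ∃ (C' : Submodule R C) (M' : Submodule R M),
      Nonempty (↥C' ≃ₗ[R] ↥M') := by
  cases subsingleton_or_nontrivial C with
  | inl _ => exact ⟨⊥, ⊥, ⟨0⟩⟩
  | inr _ =>
    obtain ⟨C', M', -, e⟩ := exists_ne_bot_equiv_of_cocritical htf hcocrit
    exact ⟨C', M', e⟩
end

section
/- Let M be a nonzero R-module which is non M-singular. Then the torsion theory τ_g generated by the class of M-singular modules in σ[M] equals χ(M), the torsion theory cogenerated by M. -/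
/- Common definitions: the category σ[M], projectivity in σ[M], the product
   K_M L of submodules, annihilators, prime/semiprime submodules, hereditary
   torsion theories, M-singular modules, etc., following the paper. -/

universe u v

/-- No nonzero element of `M` is a homomorphic image of an element of `N`, that is, every
homomorphism from a submodule of `N` to `M` vanishes. -/
def NoHomFromSub (R : Type u) [Ring R] (M : Type v) [AddCommGroup M] [Module R M]
    (N : Type v) [AddCommGroup N] [Module R N] : Prop :=
  ∀ (x : N) (m : M), (∀ r : R, r • x = 0 → r • m = 0) → m = 0

section

variable {R : Type u} [Ring R] {M : Type v} [AddCommGroup M] [Module R M]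

theorem exists_linearMap_span_singleton {N : Type v} [AddCommGroup N] [Module R N]
    (x : N) (m : M) (h : ∀ r : R, r • x = 0 → r • m = 0) :
    ∃ f : Submodule.span R {x} →ₗ[R] M,
      f ⟨x, Submodule.mem_span_singleton_self x⟩ = m ∧
        ∀ (r : R) (hr : r • x ∈ Submodule.span R {x}), f ⟨r • x, hr⟩ = r • m := by
  let g := LinearPMap.mkSpanSingleton' (σ := RingHom.id R) x m h
  exact ⟨g.toFun, LinearPMap.mkSpanSingleton'_apply_self (σ := RingHom.id R) x m h _,
    fun r hr => LinearPMap.mkSpanSingleton'_apply (σ := RingHom.id R) x m h r hr⟩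

theorem NoHomFromSub.directSum (ι : Type v) (F : ι → Type v) [DecidableEq ι]
    [∀ i, AddCommGroup (F i)] [∀ i, Module R (F i)]
    (hF : ∀ i, NoHomFromSub R M (F i)) : NoHomFromSub R M (DirectSum ι F) := by
  suffices H : ∀ (x : DirectSum ι F) (s : R) (m : M),
      (∀ r : R, r • s • x = 0 → r • m = 0) → m = 0 from
    fun x m h => H x 1 m (by simpa using h)
  intro x
  induction x using DirectSum.induction_on with
  | zero => intro s m h; simpa using h 1 (by simp)
  | of i y =>
    intro s m h
    refine hF i (s • y) m fun r hr => h r ?_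
    change r • s • DirectSum.lof R ι F i y = 0
    rw [← map_smul, ← map_smul, hr, map_zero]
  | add x y hx hy =>
    intro s m h
    refine hx s m fun r hr => hy (r * s) (r • m) fun t ht => ?_
    rw [smul_smul]
    refine h (t * r) ?_
    rw [smul_add, smul_add, mul_smul, hr, smul_zero, zero_add, mul_smul, ← mul_smul r s, ht]

variable (R M) in
/-- The hereditary torsion theory cogenerated by `M`. -/
def HTC.cogenerated : HTC.{u, v} R where
  torsion N _ _ := NoHomFromSub R M N
  closed_sub N _ _ hN K x m h :=
    hN x m fun r hr => h r (Subtype.ext hr)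
  closed_quot N _ _ hN K x m h := by
    obtain ⟨y, rfl⟩ := K.mkQ_surjective x
    exact hN y m fun r hr => h r (by rw [← map_smul, hr, map_zero])
  closed_ext N _ _ K hK hQ x m h := by
    refine hQ (K.mkQ x) m fun r hr => ?_
    have hrx : r • x ∈ K := by
      rwa [← map_smul, Submodule.mkQ_apply, Submodule.Quotient.mk_eq_zero] at hr
    refine hK ⟨r • x, hrx⟩ (r • m) fun s hs => ?_
    rw [← mul_smul]
    exact h _ (by rw [mul_smul]; exact congrArg Subtype.val hs)
  closed_iso N N' _ _ _ _ e hN x m h :=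
    hN (e.symm x) m fun r hr => h r (by
      rwa [← map_smul, LinearEquiv.map_eq_zero_iff] at hr)
  closed_dsum ι F _ _ _ hF := NoHomFromSub.directSum ι F hF

theorem torsionFreeFor_cogenerated : TorsionFreeFor R (HTC.cogenerated R M) M := by
  intro K hK
  rw [Submodule.eq_bot_iff]
  exact fun x hx => hK ⟨x, hx⟩ x fun r hr => congrArg Subtype.val hr

theorem NoHomFromSub.of_torsion {τ : HTC.{u, v} R} (hτ : TorsionFreeFor R τ M)
    {N : Type v} [AddCommGroup N] [Module R N] (hN : τ.torsion N) : NoHomFromSub R M N := by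
  intro x m h
  obtain ⟨f, hf, -⟩ := exists_linearMap_span_singleton x m h
  have ht : τ.torsion (LinearMap.range f) :=
    τ.closed_iso _ _ f.quotKerEquivRange (τ.closed_quot _ (τ.closed_sub N hN _) _)
  have hm : m ∈ LinearMap.range f := ⟨_, hf⟩
  rwa [hτ _ ht, Submodule.mem_bot] at hm

theorem InSigma.submodule {L : Type v} [AddCommGroup L] [Module R L] (hL : InSigma R M L)
    (L' : Submodule R L) : InSigma R M L' := by
  obtain ⟨ι, K, g, hg⟩ := hL
  exact ⟨ι, K, g.comp L'.subtype, hg.comp Subtype.val_injective⟩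

variable (R M) in
theorem inSigma_finsupp (ι : Type v) : InSigma R M (ι →₀ M) :=
  ⟨ι, ⊥, Submodule.mkQ ⊥, LinearMap.ker_eq_bot.mp (Submodule.ker_mkQ _)⟩

theorem IsMSingular.noHomFromSub (hns : singularSub R M = ⊥)
    {N : Type v} [AddCommGroup N] [Module R N] (hN : IsMSingular R M N) :
    NoHomFromSub R M N := by
  intro x m h
  obtain ⟨L, iL, mL, hL, K, hK, ⟨e⟩⟩ := hN
  obtain ⟨l, hl⟩ := K.mkQ_surjective (e x)
  have hx : ∀ r : R, r • l ∈ K → r • x = 0 := fun r hr => by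
    rwa [← LinearEquiv.map_eq_zero_iff e, map_smul, ← hl, ← map_smul, Submodule.mkQ_apply,
      Submodule.Quotient.mk_eq_zero]
  obtain ⟨f, hf, hf'⟩ := exists_linearMap_span_singleton l m fun r hr =>
    h r (hx r (by rw [hr]; exact K.zero_mem))
  have hs : IsMSingular R M (LinearMap.range f) := by
    refine ⟨_, _, _, hL.submodule (Submodule.span R {l}), LinearMap.ker f, ?_,
      ⟨f.quotKerEquivRange.symm⟩⟩
    intro K' hK' hbot
    refine hK (K'.map (Submodule.subtype _)) ?_ ?_
    · exact fun h0 => hK' (Submodule.map_injective_of_injective Subtype.val_injective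
        (h0.trans (Submodule.map_bot _).symm))
    · rw [Submodule.eq_bot_iff]
      rintro _ ⟨hyK, ⟨y, hy⟩, hyK', rfl⟩
      obtain ⟨r, rfl⟩ := Submodule.mem_span_singleton.mp hy
      have hker : f ⟨r • l, hy⟩ = 0 := by rw [hf', h r (hx r hyK)]
      have hmem : (⟨r • l, hy⟩ : Submodule.span R {l}) ∈ LinearMap.ker f ⊓ K' :=
        ⟨hker, hyK'⟩
      rw [hbot, Submodule.mem_bot] at hmem
      exact congrArg Subtype.val hmem
  have hm : m ∈ singularSub R M := le_sSup (a := LinearMap.range f) hs ⟨_, hf⟩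
  rwa [hns, Submodule.mem_bot] at hm

theorem NoHomFromSub.isMSingular {N : Type v} [AddCommGroup N] [Module R N]
    (hσ : InSigma R M N) (hN : NoHomFromSub R M N) : IsMSingular R M N := by
  obtain ⟨ι, K, g, hg⟩ := hσ
  let L : Submodule R (ι →₀ M) := (LinearMap.range g).comap K.mkQ
  let p : L →ₗ[R] LinearMap.range g := K.mkQ.restrict fun _ hy => hy
  have hp : Function.Surjective p := by
    rintro ⟨z, hz⟩
    obtain ⟨y, rfl⟩ := K.mkQ_surjective z
    exact ⟨⟨y, hz⟩, rfl⟩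
  let e := LinearEquiv.ofInjective g hg
  refine ⟨L, _, _, (inSigma_finsupp R M ι).submodule L, LinearMap.ker p, ?_,
    ⟨e.trans (p.quotKerEquivOfSurjective hp).symm⟩⟩
  intro K' hK' hbot
  refine hK' ((Submodule.eq_bot_iff _).mpr fun y hy => Subtype.ext (Finsupp.ext fun i => ?_))
  refine hN (e.symm (p y)) ((y : ι →₀ M) i) fun r hr => ?_
  rw [← map_smul, LinearEquiv.map_eq_zero_iff, ← map_smul] at hr
  have hmem : r • y ∈ LinearMap.ker p ⊓ K' := ⟨hr, K'.smul_mem r hy⟩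
  rw [hbot, Submodule.mem_bot] at hmem
  simpa using DFunLike.congr_fun (congrArg Subtype.val hmem) i

end


/-- Remark 2.6: if `M` is nonzero and non `M`-singular, then the
torsion theory `τ_g` generated by the `M`-singular modules coincides with
`χ(M)` on `σ[M]`. -/
theorem stmt_12 (R : Type u) [Ring R] (M : Type v) [AddCommGroup M] [Module R M]
    (hM : Nontrivial M) (hns : singularSub R M = ⊥) :
    ∀ (N : Type v) [AddCommGroup N] [Module R N], InSigma R M N →
      ((∀ τ : HTC.{u, v} R,
          (∀ (X : Type v) [AddCommGroup X] [Module R X],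
            IsMSingular R M X → τ.torsion X) → τ.torsion N) ↔
        ChiTorsion R M N) := by
  intro N _ _ hσ
  constructor
  · intro h
    exact ⟨HTC.cogenerated R M, torsionFreeFor_cogenerated,
      h _ fun X _ _ hX => hX.noHomFromSub hns⟩
  · rintro ⟨τ', hfree, hN⟩ τ hτ
    exact hτ N ((NoHomFromSub.of_torsion hfree hN).isMSingular hσ)
end
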